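/- Let p be a prime, n ≥ 1, and g ∈ ℤ[X]. Let a, b ∈ ℤ and suppose g(a) ≡ a + r·p^n (mod p^{n+1}) for an integer r, and set γ := g'(a) (the formal derivative of g evaluated at a). Then for every N ≥ 1, the N-fold iterate satisfies g^{∘N}(a + b·p^n) ≡ a + (r·(∑_{l=0}^{N−1} γ^l) + γ^N·b)·p^n (mod p^{n+1}). -/

import Mathlib

/-- `g^{∘N} : ℤ → ℤ`, the `N`-fold iterate of the polynomial map of `g`. -/
noncomputable def polyIter (g : Polynomial ℤ) (N : ℕ) : ℤ → ℤ :=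
  (fun x : ℤ => Polynomial.eval x g)^[N]

/-- First-order Taylor expansion of an integer polynomial modulo `m`, at an increment whose square
vanishes modulo `m`. -/
theorem Polynomial.eval_add_modEq_of_dvd_sq (g : Polynomial ℤ) (a : ℤ) {y m : ℤ} (h : m ∣ y ^ 2) :
    Polynomial.eval (a + y) g ≡
      Polynomial.eval a g + Polynomial.eval a (Polynomial.derivative g) * y [ZMOD m] := by
  obtain ⟨k, hk⟩ := g.binomExpansion a y
  rw [hk]
  exact (Int.modEq_iff_dvd.2 (by simpa using h.mul_left k)).symm

/-- Let `p` be prime, `n ≥ 1`, `g ∈ ℤ[X]`, `a, b, r ∈ ℤ` with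
`g(a) ≡ a + r·p^n (mod p^{n+1})`, and set `γ := g'(a)`. Then for every `N ≥ 1`,
`g^{∘N}(a + b·p^n) ≡ a + (r·(∑_{l<N} γ^l) + γ^N·b)·p^n (mod p^{n+1})`. -/
theorem iterate_taylor_congruence (p : ℕ) (hp : p.Prime) (n : ℕ) (hn : 1 ≤ n)
    (g : Polynomial ℤ) (a b r : ℤ)
    (hg : Polynomial.eval a g ≡ a + r * (p : ℤ) ^ n [ZMOD (p : ℤ) ^ (n + 1)]) :
    ∀ N : ℕ, 1 ≤ N →
      polyIter g N (a + b * (p : ℤ) ^ n) ≡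
        a + (r * (∑ l ∈ Finset.range N, (Polynomial.eval a (Polynomial.derivative g)) ^ l) +
            (Polynomial.eval a (Polynomial.derivative g)) ^ N * b) * (p : ℤ) ^ n
        [ZMOD (p : ℤ) ^ (n + 1)] := by
  intro N _
  have hsq (c : ℤ) : (p : ℤ) ^ (n + 1) ∣ (c * (p : ℤ) ^ n) ^ 2 := by
    rw [mul_pow, ← pow_mul]
    exact (pow_dvd_pow _ (by lia)).mul_left _
  clear * - hg hsq
  induction N with
  | zero => simp [polyIter]
  | succ N ih =>
    rw [polyIter, Function.iterate_succ_apply', ← polyIter]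
    have hcongr := Int.modEq_iff_dvd.2 ((Int.modEq_iff_dvd.1 ih).trans
      (Polynomial.sub_dvd_eval_sub _ _ g))
    refine (hcongr.trans (g.eval_add_modEq_of_dvd_sq a (hsq _))).trans
      ((hg.add_right _).trans (congrArg (· % (p : ℤ) ^ (n + 1)) ?_))
    rw [Finset.sum_range_succ', ← Finset.sum_congr rfl fun l _ => (pow_succ' _ l).symm,
      ← Finset.mul_sum]
    ring
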